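/- arXiv:1303.2926 — 2 statements merged into one kernel-verified Lean document; each statement's English description precedes it below -/
import Mathlib

section
/- A partial order P has no infinite strong antichains if and only if P is a finite union of ideals. -/
/-- A strong antichain: a set of pairwise incompatible elements. -/
def IsStrongAntichainPO {α : Type*} [PartialOrder α] (S : Set α) : Prop :=
  ∀ x ∈ S, ∀ y ∈ S, x ≠ y → ¬ ∃ z, x ≤ z ∧ y ≤ z

/-- An ideal of a partial order: a lower set in which any two elements have a
common upper bound lying in the set. -/
def IsIdealPO {α : Type*} [PartialOrder α] (A : Set α) : Prop :=
  IsLowerSet A ∧ ∀ x ∈ A, ∀ y ∈ A, ∃ z ∈ A, x ≤ z ∧ y ≤ z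

/-- A strong antichain meets an ideal in at most one point. -/
theorem IsStrongAntichainPO.subsingleton_inter {α : Type*} [PartialOrder α] {S A : Set α}
    (hS : IsStrongAntichainPO S) (hA : IsIdealPO A) : (S ∩ A).Subsingleton := by
  rintro x ⟨hxS, hxA⟩ y ⟨hyS, hyA⟩
  by_contra hxy
  obtain ⟨z, -, hz⟩ := hA.2 x hxA y hyA
  exact hS x hxS y hyS hxy ⟨z, hz⟩

/-- If there are no infinite strong antichains, every element lies below some `d` above which any
two elements are compatible. -/
theorem exists_le_forall_compatible {α : Type*} [PartialOrder α]
    (h : ∀ S : Set α, IsStrongAntichainPO S → S.Finite) (x : α) :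
    ∃ d, x ≤ d ∧ ∀ y z, d ≤ y → d ≤ z → ∃ w, y ≤ w ∧ z ≤ w := by
  by_contra! hx
  have split : ∀ d : {d // x ≤ d}, ∃ p : α × {d // x ≤ d},
      d.1 ≤ p.1 ∧ d ≤ p.2 ∧ ¬ ∃ w, p.1 ≤ w ∧ p.2.1 ≤ w := by
    rintro ⟨d, hd⟩
    obtain ⟨y, z, hy, hz, hyz⟩ := hx d hd
    exact ⟨(y, ⟨z, hd.trans hz⟩), hy, hz, fun ⟨w, h₁, h₂⟩ => hyz w h₁ h₂⟩
  choose f hf₁ hf₂ hf using split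
  let u : ℕ → {d // x ≤ d} := fun n => Nat.rec ⟨x, le_rfl⟩ (fun _ d => (f d).2) n
  let a : ℕ → α := fun n => (f (u n)).1
  have hu : Monotone u := monotone_nat_of_le_succ fun n => hf₂ (u n)
  have ha : ∀ m n, m < n → ¬ ∃ w, a m ≤ w ∧ a n ≤ w := by
    rintro m n hmn ⟨w, h₁, h₂⟩
    have hle : (u (m + 1)).1 ≤ (u n).1 := hu hmn
    exact hf (u m) ⟨w, h₁, (hle.trans (hf₁ (u n))).trans h₂⟩
  have hinj : Function.Injective a := by
    intro m n hmn
    rcases lt_trichotomy m n with hlt | heq | hlt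
    · exact (ha m n hlt ⟨a n, hmn.le, le_rfl⟩).elim
    · exact heq
    · exact (ha n m hlt ⟨a n, le_rfl, hmn.le⟩).elim
  refine Set.infinite_range_of_injective hinj (h _ ?_)
  rintro _ ⟨m, rfl⟩ _ ⟨n, rfl⟩ hne ⟨w, h₁, h₂⟩
  rcases lt_trichotomy m n with hlt | heq | hlt
  · exact ha m n hlt ⟨w, h₁, h₂⟩
  · exact hne (congrArg a heq)
  · exact ha n m hlt ⟨w, h₂, h₁⟩

/-- Every set contains a maximal strong antichain. -/
theorem exists_maximal_strongAntichain {α : Type*} [PartialOrder α] (D : Set α) :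
    ∃ S, Maximal (fun S => S ⊆ D ∧ IsStrongAntichainPO S) S := by
  refine zorn_subset {S | S ⊆ D ∧ IsStrongAntichainPO S} fun c hc hchain =>
    ⟨⋃₀ c, ⟨Set.sUnion_subset fun s hs => (hc hs).1, ?_⟩, fun s hs => Set.subset_sUnion_of_mem hs⟩
  rintro x ⟨s, hs, hxs⟩ y ⟨t, ht, hyt⟩ hxy
  rcases hchain.total hs ht with hst | hts
  · exact (hc ht).2 x (hst hxs) y hyt hxy
  · exact (hc hs).2 x hxs y (hts hyt) hxy

/-- A partial order has no infinite strong antichains iff it is a finite union of ideals. -/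
theorem stmt2 {α : Type*} [PartialOrder α] :
    (∀ S : Set α, IsStrongAntichainPO S → S.Finite) ↔
      (∃ F : Finset (Set α), (∀ A ∈ F, IsIdealPO A) ∧ ⋃₀ ↑F = (Set.univ : Set α)) := by
  classical
  constructor
  · intro h
    let D : Set α := {d | ∀ y z, d ≤ y → d ≤ z → ∃ w, y ≤ w ∧ z ≤ w}
    obtain ⟨S, hS⟩ := exists_maximal_strongAntichain D
    have hfin := h S hS.prop.2
    refine ⟨hfin.toFinset.image fun d => {x | ∃ y, d ≤ y ∧ x ≤ y}, ?_, ?_⟩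
    · intro A hA
      obtain ⟨d, hd, rfl⟩ := Finset.mem_image.1 hA
      have hdD : d ∈ D := hS.prop.1 (hfin.mem_toFinset.1 hd)
      refine ⟨fun a b hba ⟨y, hdy, hay⟩ => ⟨y, hdy, hba.trans hay⟩, ?_⟩
      rintro x ⟨y, hdy, hxy⟩ x' ⟨y', hdy', hxy'⟩
      obtain ⟨w, hw, hw'⟩ := hdD y y' hdy hdy'
      exact ⟨w, ⟨w, hdy.trans hw, le_rfl⟩, hxy.trans hw, hxy'.trans hw'⟩
    · refine Set.eq_univ_of_forall fun x => ?_
      obtain ⟨e, hxe, heD⟩ := exists_le_forall_compatible h x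
      have key : ∃ d ∈ S, ∃ w, d ≤ w ∧ e ≤ w := by
        by_contra hcon
        have hins : insert e S ⊆ D ∧ IsStrongAntichainPO (insert e S) := by
          refine ⟨Set.insert_subset heD hS.prop.1, ?_⟩
          rintro a (rfl | ha) b (rfl | hb) hab ⟨w, h₁, h₂⟩
          · exact hab rfl
          · exact hcon ⟨b, hb, w, h₂, h₁⟩
          · exact hcon ⟨a, ha, w, h₁, h₂⟩
          · exact hS.prop.2 a ha b hb hab ⟨w, h₁, h₂⟩
        have heS : e ∈ S := hS.le_of_ge hins (Set.subset_insert e S) (Set.mem_insert e S)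
        exact hcon ⟨e, heS, e, le_rfl, le_rfl⟩
      obtain ⟨d, hd, w, hdw, hew⟩ := key
      exact ⟨_, Finset.mem_coe.2 (Finset.mem_image_of_mem _ (hfin.mem_toFinset.2 hd)),
        w, hdw, hxe.trans hew⟩
  · rintro ⟨F, hF, hcover⟩ S hS
    have hSF : S = ⋃ A ∈ F, S ∩ A := by
      ext x
      have hx : x ∈ ⋃₀ (F : Set (Set α)) := hcover ▸ Set.mem_univ x
      obtain ⟨A, hA, hxA⟩ := hx
      simp only [Set.mem_iUnion, Set.mem_inter_iff]
      exact ⟨fun hxS => ⟨A, hA, hxS, hxA⟩, fun ⟨_, _, hxS, _⟩ => hxS⟩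
    rw [hSF]
    exact F.finite_toSet.biUnion fun A hA => (hS.subsingleton_inter (hF A hA)).finite
end

section
/- A countable partial order P is scattered and has no infinite antichains if and only if the collection of all initial intervals of P is countable. -/
/-- A set `A` is thin if the lower sets of the ambient order have countably many traces on it. -/
def IsThin {α : Type*} [Preorder α] (A : Set α) : Prop :=
  ((fun I : Set α => I ∩ A) '' {I | IsLowerSet I}).Countable

/-- The elements of `Q` incomparable with `x`. -/
def incomparables {α : Type*} [Preorder α] (Q : Set α) (x : α) : Set α :=
  {y ∈ Q | ¬ x ≤ y ∧ ¬ y ≤ x}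

section Thin

variable {α : Type*} [PartialOrder α]

theorem isThin_univ_iff :
    IsThin (Set.univ : Set α) ↔ {I : Set α | IsLowerSet I}.Countable := by
  simp [IsThin]

theorem IsThin.mono {A B : Set α} (hB : IsThin B) (h : A ⊆ B) : IsThin A := by
  refine (hB.image (· ∩ A)).mono ?_
  rintro _ ⟨I, hI, rfl⟩
  refine ⟨I ∩ B, ⟨I, hI, rfl⟩, ?_⟩
  ext z
  simp only [Set.mem_inter_iff]
  exact ⟨fun hz => ⟨hz.1.1, hz.2⟩, fun hz => ⟨⟨hz.1, h hz.2⟩, hz.2⟩⟩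

theorem IsThin.union {A B : Set α} (hA : IsThin A) (hB : IsThin B) : IsThin (A ∪ B) := by
  refine (Set.Countable.image2 hA hB (· ∪ ·)).mono ?_
  rintro _ ⟨I, hI, rfl⟩
  exact ⟨I ∩ A, ⟨I, hI, rfl⟩, I ∩ B, ⟨I, hI, rfl⟩, (Set.inter_union_distrib_left I A B).symm⟩

theorem Set.Finite.isThin {A : Set α} (hA : A.Finite) : IsThin A := by
  refine hA.finite_subsets.countable.mono ?_
  rintro _ ⟨I, -, rfl⟩
  exact Set.inter_subset_right

/-- The points of `Q` with a thin upper part form a thin set. -/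
theorem isThin_setOf_isThin_Ici [Countable α] {Q : Set α}
    (hQ : ∀ x ∈ Q, IsThin (incomparables Q x)) :
    IsThin {x ∈ Q | IsThin (Set.Ici x ∩ Q)} := by
  set A := {x ∈ Q | IsThin (Set.Ici x ∩ Q)}
  have hdiff : ∀ x ∈ A, IsThin (A \ Set.Iic x) := fun x hx =>
    (hx.2.union (hQ x hx.1)).mono fun y hy => by
      by_cases hxy : x ≤ y
      · exact Or.inl ⟨hxy, hy.1.1⟩
      · exact Or.inr ⟨hy.1.1, hxy, hy.2⟩
  refine ((Set.countable_singleton (∅ : Set α)).union (Set.Countable.biUnion A.to_countable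
    fun x hx => (hdiff x hx).image ((Set.Iic x ∩ A) ∪ ·))).mono ?_
  rintro _ ⟨I, hI, rfl⟩
  rcases (I ∩ A).eq_empty_or_nonempty with h | ⟨x, hxI, hxA⟩
  · exact Or.inl h
  · refine Or.inr (Set.mem_biUnion hxA ⟨I ∩ (A \ Set.Iic x), ⟨I, hI, rfl⟩, ?_⟩)
    ext z
    have : z ≤ x → z ∈ I := fun hz => hI hz hxI
    simp only [Set.mem_union, Set.mem_inter_iff, Set.mem_sdiff, Set.mem_Iic]
    tauto

/-- The points of `Q` with a thin lower part form a thin set. -/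
theorem isThin_setOf_isThin_Iic [Countable α] {Q : Set α}
    (hQ : ∀ x ∈ Q, IsThin (incomparables Q x)) :
    IsThin {x ∈ Q | IsThin (Set.Iic x ∩ Q)} := by
  set A := {x ∈ Q | IsThin (Set.Iic x ∩ Q)}
  have hdiff : ∀ x ∈ A, IsThin (A \ Set.Ici x) := fun x hx =>
    (hx.2.union (hQ x hx.1)).mono fun y hy => by
      by_cases hxy : y ≤ x
      · exact Or.inl ⟨hxy, hy.1.1⟩
      · exact Or.inr ⟨hy.1.1, hy.2, hxy⟩
  refine ((Set.countable_singleton A).union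
    (Set.Countable.biUnion A.to_countable fun x hx => hdiff x hx)).mono ?_
  rintro _ ⟨I, hI, rfl⟩
  by_cases h : A ⊆ I
  · exact Or.inl (Set.inter_eq_right.2 h)
  · obtain ⟨x, hxA, hxI⟩ := Set.not_subset.1 h
    refine Or.inr (Set.mem_biUnion hxA ⟨I, hI, ?_⟩)
    ext z
    have : x ≤ z → z ∉ I := fun hz hzI => hxI (hI hz hzI)
    simp only [Set.mem_inter_iff, Set.mem_sdiff, Set.mem_Ici]
    tauto

theorem exists_not_isThin_Ici_and_Iic [Countable α] {Q : Set α}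
    (hQ : ∀ x ∈ Q, IsThin (incomparables Q x)) (h : ¬ IsThin Q) :
    ∃ x ∈ Q, ¬ IsThin (Set.Ici x ∩ Q) ∧ ¬ IsThin (Set.Iic x ∩ Q) := by
  by_contra! hcon
  refine h (((isThin_setOf_isThin_Ici hQ).union (isThin_setOf_isThin_Iic hQ)).mono fun x hx => ?_)
  by_cases hx' : IsThin (Set.Ici x ∩ Q)
  · exact Or.inl ⟨hx, hx'⟩
  · exact Or.inr ⟨hx, hcon x hx hx'⟩

theorem isThin_incomparables_of_subset {Q Q' : Set α}
    (hQ : ∀ x ∈ Q, IsThin (incomparables Q x)) (h : Q' ⊆ Q) :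
    ∀ x ∈ Q', IsThin (incomparables Q' x) :=
  fun x hx => (hQ x (h hx)).mono fun _ hy => ⟨h hy.1, hy.2⟩

theorem exists_not_isThin_forall_isThin_incomparables
    (hfin : ∀ D : Set α, IsAntichain (· ≤ ·) D → D.Finite) (h : ¬ IsThin (Set.univ : Set α)) :
    ∃ Q : Set α, ¬ IsThin Q ∧ ∀ x ∈ Q, IsThin (incomparables Q x) := by
  by_contra! hcon
  choose f hfQ hf using hcon
  let next : {Q : Set α // ¬ IsThin Q} → {Q : Set α // ¬ IsThin Q} :=
    fun Q => ⟨incomparables Q.1 (f Q.1 Q.2), hf Q.1 Q.2⟩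
  let S : ℕ → {Q : Set α // ¬ IsThin Q} := fun n => next^[n] ⟨Set.univ, h⟩
  have hS : ∀ n, S (n + 1) = next (S n) := fun n => Function.iterate_succ_apply' next n _
  have hanti : Antitone fun n => (S n).1 := antitone_nat_of_succ_le fun n y hy => by
    rw [hS] at hy
    exact hy.1
  let x : ℕ → α := fun n => f (S n).1 (S n).2
  have hinc : ∀ m n, m < n → ¬ x m ≤ x n ∧ ¬ x n ≤ x m := fun m n hmn => by
    have hx : x n ∈ (S (m + 1)).1 := hanti (Nat.succ_le_of_lt hmn) (hfQ _ _)
    rw [hS] at hx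
    exact hx.2
  have hinc' : ∀ m n, m ≠ n → ¬ x m ≤ x n := fun m n hmn =>
    hmn.lt_or_gt.elim (fun hlt => (hinc m n hlt).1) fun hlt => (hinc n m hlt).2
  refine Set.infinite_range_of_injective (f := x) (fun m n hmn => ?_) (hfin _ ?_)
  · by_contra hne
    exact hinc' m n hne hmn.le
  · rintro _ ⟨m, rfl⟩ _ ⟨n, rfl⟩ hne
    exact hinc' m n fun hmn => hne (congrArg x hmn)

/-- A nonempty dense transitive relation contained in `<` yields a copy of the rationals. -/
theorem nonempty_rat_orderEmbedding_of_dense {r : α → α → Prop}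
    (hlt : ∀ x y, r x y → x < y) (htrans : ∀ x y z, r x y → r y z → r x z)
    (hdense : ∀ x y, r x y → ∃ z, r x z ∧ r z y) {a b : α} (hab : r a b) :
    Nonempty (ℚ ↪o α) := by
  have hchain : IsChain r {a, b} := by
    rintro x (rfl | rfl) y (rfl | rfl) hne
    · exact absurd rfl hne
    · exact Or.inl hab
    · exact Or.inr hab
    · exact absurd rfl hne
  obtain ⟨C, hC, hsub⟩ := IsChain.exists_maxChain hchain
  have hr : ∀ x ∈ C, ∀ y ∈ C, x < y → r x y := fun x hx y hy hxy =>
    (hC.1 hx hy hxy.ne).resolve_right fun h => lt_asymm hxy (hlt _ _ h)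
  have htot : ∀ x y : C, x ≤ y ∨ y ≤ x := fun x y => by
    by_cases hxy : x = y
    · exact Or.inl hxy.le
    · exact (hC.1 x.2 y.2 fun h => hxy (Subtype.ext h)).imp
        (fun h => (hlt _ _ h).le) fun h => (hlt _ _ h).le
  let _ : LinearOrder C :=
    { (inferInstance : PartialOrder C) with
      le_total := htot
      toDecidableLE := Classical.decRel _ }
  have : DenselyOrdered C := ⟨fun x y hxy => by
    by_contra! hgap
    obtain ⟨z, hxz, hzy⟩ := hdense _ _ (hr x x.2 y y.2 hxy)
    have hins : IsChain r (insert z C) := hC.1.insert fun w hw _ => by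
      rcases le_or_gt (⟨w, hw⟩ : C) x with hwx | hxw
      · right
        rcases hwx.eq_or_lt with h | h
        · exact (show w = x from congrArg Subtype.val h) ▸ hxz
        · exact htrans _ _ _ (hr w hw x x.2 h) hxz
      · left
        rcases (hgap _ hxw).eq_or_lt with h | h
        · exact (show y = w from congrArg Subtype.val h) ▸ hzy
        · exact htrans _ _ _ hzy (hr y y.2 w hw h)
    have hz : z ∈ C := hC.2 hins (Set.subset_insert z C) ▸ Set.mem_insert z C
    exact (hgap ⟨z, hz⟩ (hlt _ _ hxz)).not_gt (hlt _ _ hzy)⟩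
  have : Nontrivial C :=
    ⟨⟨a, hsub (by simp)⟩, ⟨b, hsub (by simp)⟩, fun h => (hlt _ _ hab).ne (congrArg Subtype.val h)⟩
  obtain ⟨e⟩ := Order.embedding_from_countable_to_dense ℚ C
  exact ⟨e.trans (OrderEmbedding.subtype (· ∈ C))⟩

theorem nonempty_rat_orderEmbedding_of_not_isThin [Countable α] {Q : Set α}
    (hQ : ∀ x ∈ Q, IsThin (incomparables Q x)) (h : ¬ IsThin Q) : Nonempty (ℚ ↪o α) := by
  obtain ⟨a, -, ha, -⟩ := exists_not_isThin_Ici_and_Iic hQ h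
  obtain ⟨b, hb, -, hab⟩ := exists_not_isThin_Ici_and_Iic
    (isThin_incomparables_of_subset hQ Set.inter_subset_right) ha
  have hne : ∀ {x y : α} {s : Set α}, s ⊆ Set.Icc x y → ¬ IsThin s → x ≠ y := by
    rintro x _ s hs hthin rfl
    rw [Set.Icc_self] at hs
    exact hthin ((Set.finite_singleton x).subset hs).isThin
  refine nonempty_rat_orderEmbedding_of_dense (a := a) (b := b)
    (r := fun x y => x < y ∧ ¬ IsThin (Set.Icc x y ∩ Q)) (fun _ _ hxy => hxy.1) ?_ ?_ ?_
  · exact fun x y z hxy hyz => ⟨hxy.1.trans hyz.1, fun hthin => hxy.2 (hthin.mono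
      (Set.inter_subset_inter_left Q (Set.Icc_subset_Icc_right hyz.1.le)))⟩
  · rintro x y ⟨-, hxy⟩
    obtain ⟨z, hz, hzy, hxz⟩ := exists_not_isThin_Ici_and_Iic
      (isThin_incomparables_of_subset hQ Set.inter_subset_right) hxy
    refine ⟨z, ⟨hz.1.1.lt_of_ne (hne (fun w hw => ⟨hw.2.1.1, hw.1⟩) hxz), fun hthin => ?_⟩,
      hz.1.2.lt_of_ne (hne (fun w hw => ⟨hw.1, hw.2.1.2⟩) hzy), fun hthin => ?_⟩
    · exact hxz (hthin.mono fun w hw => ⟨⟨hw.2.1.1, hw.1⟩, hw.2.2⟩)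
    · exact hzy (hthin.mono fun w hw => ⟨⟨hw.1, hw.2.1.2⟩, hw.2.2⟩)
  · refine ⟨hb.1.lt_of_ne (hne (fun w hw => ⟨hw.2.1, hw.1⟩) hab), fun hthin => ?_⟩
    exact hab (hthin.mono fun w hw => ⟨⟨hw.2.1, hw.1⟩, hw.2.2⟩)

end Thin

theorem not_countable_isLowerSet_of_rat_orderEmbedding {α : Type*} [Preorder α] (f : ℚ ↪o α) :
    ¬ {I : Set α | IsLowerSet I}.Countable := by
  intro h
  have := h.to_subtype
  let g : ℝ → {I : Set α | IsLowerSet I} := fun r =>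
    ⟨lowerClosure (f '' {q : ℚ | (q : ℝ) < r}), (lowerClosure _).lower⟩
  have hg : ∀ r (q : ℚ), f q ∈ (g r).1 ↔ (q : ℝ) < r := by
    intro r q
    simp only [g, SetLike.mem_coe, mem_lowerClosure, Set.exists_mem_image, Set.mem_ofPred_eq,
      OrderEmbedding.le_iff_le]
    exact ⟨fun ⟨p, hp, hqp⟩ => (Rat.cast_le.2 hqp).trans_lt hp, fun hq => ⟨q, hq, le_rfl⟩⟩
  have hle : ∀ r s, g r = g s → r ≤ s := fun r s hrs => by
    by_contra! hsr
    obtain ⟨q, hsq, hqr⟩ := exists_rat_btwn hsr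
    exact hsq.not_gt ((hg s q).1 (hrs ▸ (hg r q).2 hqr))
  have hinj : Function.Injective g := fun r s hrs => (hle r s hrs).antisymm (hle s r hrs.symm)
  exact not_countable (hinj.countable : Countable ℝ)

theorem IsAntichain.finite_of_countable_isLowerSet {α : Type*} [Preorder α] {D : Set α}
    (hD : IsAntichain (· ≤ ·) D) (h : {I : Set α | IsLowerSet I}.Countable) : D.Finite := by
  by_contra hinf
  have := h.to_subtype
  have : Infinite D := Set.infinite_coe_iff.2 hinf
  let g : Set D → {I : Set α | IsLowerSet I} := fun s =>
    ⟨lowerClosure (Subtype.val '' s), (lowerClosure _).lower⟩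
  have hg : ∀ s (d : D), d.1 ∈ (g s).1 ↔ d ∈ s := by
    intro s d
    simp only [g, SetLike.mem_coe, mem_lowerClosure, Set.exists_mem_image]
    exact ⟨fun ⟨e, he, hde⟩ => Subtype.ext (hD.eq d.2 e.2 hde) ▸ he, fun hd => ⟨d, hd, le_rfl⟩⟩
  have hinj : Function.Injective g := fun s t hst => Set.ext fun d => by rw [← hg, ← hg, hst]
  have : Countable (Set D) := hinj.countable
  have hle : Cardinal.mk (Set D) ≤ Cardinal.aleph0 := Cardinal.mk_le_aleph0
  rw [Cardinal.mk_set] at hle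
  exact ((Cardinal.cantor _).trans_le hle).not_ge (Cardinal.aleph0_le_mk D)


/-- A countable partial order is scattered and has no infinite antichains iff it has
countably many initial intervals. -/
theorem stmt4 {α : Type*} [PartialOrder α] [Countable α] :
    (IsEmpty (ℚ ↪o α) ∧ ∀ D : Set α, IsAntichain (· ≤ ·) D → D.Finite) ↔
      {I : Set α | IsLowerSet I}.Countable := by
  refine ⟨fun ⟨hscat, hfin⟩ => ?_, fun h => ⟨⟨fun f => ?_⟩, fun D hD => ?_⟩⟩
  · rw [← isThin_univ_iff]
    by_contra hthin
    obtain ⟨Q, hQ, hinc⟩ := exists_not_isThin_forall_isThin_incomparables hfin hthin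
    exact not_isEmpty_iff.2 (nonempty_rat_orderEmbedding_of_not_isThin hinc hQ) hscat
  · exact not_countable_isLowerSet_of_rat_orderEmbedding f h
  · exact hD.finite_of_countable_isLowerSet h
end
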